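/- Fix k ≥ 1 and let M₁, M₂ be two postulated models with complete separable metric parameter spaces Θ₁, Θ₂, priors π₁, π₂, and parameter values θ̃₁ ∈ Θ₁, θ̃₂ ∈ Θ₂. Suppose there are fixed points x*_{ij} ∈ 𝒳 (the almost-sure limits of the prior sets B_{im}(θ̃_j) as m → ∞, j = 1,2) such that for j = 1,2: P-almost surely, lim_{m→∞} limsup_{n→∞} sup_{1≤i≤n} |log π(y_{ik}|Y_{nm,−i},X_{n,−i},M_j) − log f_{M_j}(y_{ik}|θ̃_j, x*_{ij}, Y^{(i−1)}_k)| = 0, and P-almost surely the limits h*_j(θ̃_j) = lim_{n→∞} (1/n) Σ_{i=1}^n log[ f_{M₀}(y_{ik}|θ₀,x_i,Y^{(i−1)}_k) / f_{M_j}(y_{ik}|θ̃_j,x*_{ij},Y^{(i−1)}_k) ] exist and are finite. Then P-almost surely lim_{m→∞} limsup_{n→∞} | (1/n) log IPBF^{(n,m,k)}(M₁,M₂) + (h*₁(θ̃₁) − h*₂(θ̃₂)) | = 0, i.e., in the iterated limit (1/n) log IPBF^{(n,m,k)}(M₁,M₂) converges to −(h*₁(θ̃₁) − h*₂(θ̃₂)).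 -/

import Mathlib

open MeasureTheory Filter Finset

/-- Averages of two families that are uniformly `δ`-close are `δ`-close. -/
theorem abs_average_sub_average_le {a b : ℕ → ℝ} {n : ℕ} {δ : ℝ} (hδ : 0 ≤ δ)
    (h : ∀ i ∈ Finset.Icc 1 n, |a i - b i| ≤ δ) :
    |(1 / (n : ℝ)) * ∑ i ∈ Finset.Icc 1 n, a i - (1 / (n : ℝ)) * ∑ i ∈ Finset.Icc 1 n, b i|
      ≤ δ := by
  rcases Nat.eq_zero_or_pos n with rfl | hn
  · simpa using hδ
  have hn' : (0 : ℝ) < n := by exact_mod_cast hn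
  have hsum : |∑ i ∈ Finset.Icc 1 n, (a i - b i)| ≤ n * δ :=
    (Finset.abs_sum_le_sum_abs _ _).trans
      ((Finset.sum_le_card_nsmul _ _ _ h).trans_eq (by simp))
  rw [← mul_sub, ← Finset.sum_sub_distrib, abs_mul, abs_of_pos (by positivity : 0 < 1 / (n : ℝ)),
    one_div, inv_mul_le_iff₀ hn']
  exact hsum

/-- **Convergence of the inverse pseudo-Bayes factor for two postulated models (second
setup).**  With `m` replicated responses at each fixed covariate `x_i` and a fixed
replication index `k ≥ 1`: for `j = 1, 2`, `fMj i θ x ω = f_{M_j}(y_{ik} | θ, x,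
Y^{(i-1)}_k)` are the densities of model `M_j` at covariate value `x`, `cvMj n m i ω =
π(y_{ik} | Y_{nm,-i}, X_{n,-i}, M_j)` the inverse cross-validation densities (the
unobserved covariate carrying the uniform prior on `B_{im}(θ)`), `fM0 i ω` the densities
of the true model `M₀` at `(θ₀, x_i)`, and
`IPBF^{(n,m,k)}(M₁, M₂) = ∏_{i=1}^n cvM1 n m i / ∏_{i=1}^n cvM2 n m i`.
If `x*_{ij}` are the almost-sure limits of the prior sets `B_{im}(θ̃_j)`, the log
cross-validation densities of each `M_j` converge in the iterated limit (first `n → ∞`,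
then `m → ∞`), uniformly in `1 ≤ i ≤ n`, to the plug-in log-densities at `(θ̃_j, x*_{ij})`,
and the rates `h*_j(θ̃_j) = lim (1/n) ∑ log (fM0 i / fMj i θ̃_j x*_{ij})` exist a.s. and
are finite, then `P`-a.s.
`lim_{m→∞} limsup_{n→∞} |(1/n) log IPBF^{(n,m,k)}(M₁,M₂) + (h*₁(θ̃₁) - h*₂(θ̃₂))| = 0`. -/
theorem ipbf_convergence_two_models_second_setup
    {Ω : Type*} [MeasurableSpace Ω] (P : Measure Ω) [IsProbabilityMeasure P]
    -- covariate space
    {𝒳 : Type*} [MetricSpace 𝒳] [CompleteSpace 𝒳] [TopologicalSpace.SeparableSpace 𝒳]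
    -- parameter spaces of the two postulated models with their priors
    {Θ₁ : Type*} [MetricSpace Θ₁] [CompleteSpace Θ₁] [TopologicalSpace.SeparableSpace Θ₁]
    [MeasurableSpace Θ₁] [BorelSpace Θ₁] (π₁ : Measure Θ₁) [IsProbabilityMeasure π₁]
    {Θ₂ : Type*} [MetricSpace Θ₂] [CompleteSpace Θ₂] [TopologicalSpace.SeparableSpace Θ₂]
    [MeasurableSpace Θ₂] [BorelSpace Θ₂] (π₂ : Measure Θ₂) [IsProbabilityMeasure π₂]
    -- densities of `M₁` and `M₂` (at replication `k`) as functions of the covariate value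
    (fM1 : ℕ → Θ₁ → 𝒳 → Ω → ℝ) (fM2 : ℕ → Θ₂ → 𝒳 → Ω → ℝ)
    -- densities of the true model `M₀` at `θ₀` and the observed covariates `x_i`
    (fM0 : ℕ → Ω → ℝ)
    -- inverse cross-validation densities, indices (n, m, i)
    (cvM1 cvM2 : ℕ → ℕ → ℕ → Ω → ℝ)
    -- strict positivity of all densities
    (hfM1pos : ∀ i θ x ω, 0 < fM1 i θ x ω)
    (hfM2pos : ∀ i θ x ω, 0 < fM2 i θ x ω)
    (hfM0pos : ∀ i ω, 0 < fM0 i ω)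
    (hcvM1pos : ∀ n m i ω, 0 < cvM1 n m i ω)
    (hcvM2pos : ∀ n m i ω, 0 < cvM2 n m i ω)
    -- the points `θ̃_j`, the limits `x*_{ij}` of the prior sets `B_{im}(θ̃_j)`, and `h*_j(θ̃_j)`
    (θt1 : Θ₁) (θt2 : Θ₂) (xstar1 xstar2 : ℕ → 𝒳) (hstar1 hstar2 : ℝ)
    -- iterated uniform convergence of log cross-validation densities, model `M₁`
    (ha1 : ∀ᵐ ω ∂P, ∀ ε > (0 : ℝ), ∀ᶠ m : ℕ in atTop, ∀ᶠ n : ℕ in atTop,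
      ∀ i ∈ Finset.Icc 1 n,
        |Real.log (cvM1 n m i ω) - Real.log (fM1 i θt1 (xstar1 i) ω)| < ε)
    -- iterated uniform convergence of log cross-validation densities, model `M₂`
    (ha2 : ∀ᵐ ω ∂P, ∀ ε > (0 : ℝ), ∀ᶠ m : ℕ in atTop, ∀ᶠ n : ℕ in atTop,
      ∀ i ∈ Finset.Icc 1 n,
        |Real.log (cvM2 n m i ω) - Real.log (fM2 i θt2 (xstar2 i) ω)| < ε)
    -- a.s. existence and finiteness of `h*₁(θ̃₁)`
    (hc1 : ∀ᵐ ω ∂P, Tendsto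
      (fun n : ℕ => (1 / (n : ℝ)) * ∑ i ∈ Finset.Icc 1 n,
        Real.log (fM0 i ω / fM1 i θt1 (xstar1 i) ω))
      atTop (nhds hstar1))
    -- a.s. existence and finiteness of `h*₂(θ̃₂)`
    (hc2 : ∀ᵐ ω ∂P, Tendsto
      (fun n : ℕ => (1 / (n : ℝ)) * ∑ i ∈ Finset.Icc 1 n,
        Real.log (fM0 i ω / fM2 i θt2 (xstar2 i) ω))
      atTop (nhds hstar2)) :
    -- conclusion: `lim_{m→∞} limsup_{n→∞}
    --   |(1/n) log IPBF^{(n,m,k)}(M₁,M₂) + (h*₁(θ̃₁) - h*₂(θ̃₂))| = 0` a.s.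
    ∀ᵐ ω ∂P, ∀ ε > (0 : ℝ), ∀ᶠ m : ℕ in atTop, ∀ᶠ n : ℕ in atTop,
      |(1 / (n : ℝ)) * Real.log
          ((∏ i ∈ Finset.Icc 1 n, cvM1 n m i ω) / (∏ i ∈ Finset.Icc 1 n, cvM2 n m i ω))
        + (hstar1 - hstar2)| < ε := by
  filter_upwards [ha1, ha2, hc1, hc2] with ω h1 h2 l1 l2 ε hε
  have hε4 : 0 < ε / 4 := by positivity
  filter_upwards [h1 (ε / 4) hε4, h2 (ε / 4) hε4] with m h1m h2m
  filter_upwards [h1m, h2m, Metric.tendsto_nhds.1 l1 (ε / 4) hε4,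
    Metric.tendsto_nhds.1 l2 (ε / 4) hε4] with n h1n h2n l1n l2n
  have d1 := abs_average_sub_average_le hε4.le fun i hi => (h1n i hi).le
  have d2 := abs_average_sub_average_le hε4.le fun i hi => (h2n i hi).le
  rw [Real.dist_eq] at l1n l2n
  simp only [Real.log_div (hfM0pos _ ω).ne' (hfM1pos _ _ _ ω).ne',
    Finset.sum_sub_distrib, mul_sub] at l1n
  simp only [Real.log_div (hfM0pos _ ω).ne' (hfM2pos _ _ _ ω).ne',
    Finset.sum_sub_distrib, mul_sub] at l2n
  rw [Real.log_div (Finset.prod_pos fun i _ => hcvM1pos n m i ω).ne'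
      (Finset.prod_pos fun i _ => hcvM2pos n m i ω).ne',
    Real.log_prod fun i _ => (hcvM1pos n m i ω).ne',
    Real.log_prod fun i _ => (hcvM2pos n m i ω).ne', mul_sub]
  rw [abs_le] at d1 d2
  rw [abs_lt] at l1n l2n ⊢
  constructor <;> linarith
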